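/- With the second bracket {F,G}_1 := Σ_i λ_i(∂F/∂μ_i ∂G/∂λ_i − ∂F/∂λ_i ∂G/∂μ_i) on smooth functions on U, for all real x ≠ y one has {B(x), A(y)}_1 = (η/(x−y))·(x·B(x)A(y) − y·B(y)A(x)) − (ηβ/α)·A(x)A(y). -/

import Mathlib

noncomputable section

/-- The open set `U ⊂ ℝ^{2n}` of points `(λ, μ)` with the `λ_i` pairwise distinct. -/
def U (n : ℕ) : Set ((Fin n → ℝ) × (Fin n → ℝ)) := {z | Function.Injective z.1}

/-- `A(x) := α ∏_{i=1}^n (x − λ_i)`. -/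
def Afun (n : ℕ) (α : ℝ) (x : ℝ) (z : (Fin n → ℝ) × (Fin n → ℝ)) : ℝ :=
  α * ∏ i, (x - z.1 i)

/-- `A'(λ_i)`, the derivative of the polynomial `A` at `λ_i`. -/
def Ader (n : ℕ) (α : ℝ) (z : (Fin n → ℝ) × (Fin n → ℝ)) (i : Fin n) : ℝ :=
  deriv (fun x => Afun n α x z) (z.1 i)

/-- The polynomial `A(x)/(x − λ_i) = α ∏_{j ≠ i} (x − λ_j)`. -/
def lagr (n : ℕ) (α : ℝ) (z : (Fin n → ℝ) × (Fin n → ℝ)) (i : Fin n) (x : ℝ) : ℝ :=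
  α * ∏ j ∈ Finset.univ.erase i, (x - z.1 j)

/-- `B(x) := A(x)(β/α + Σ_i e^{ημ_i}/((x−λ_i)A'(λ_i)))`, written with the polynomial
`A(x)/(x−λ_i)`, so `B` is a polynomial in `x`. -/
def Bfun (n : ℕ) (α β η : ℝ) (x : ℝ) (z : (Fin n → ℝ) × (Fin n → ℝ)) : ℝ :=
  (β / α) * Afun n α x z + ∑ i, Real.exp (η * z.2 i) * lagr n α z i x / Ader n α z i

/-- `C(x) := A(x)(γ/α − Σ_i d(λ_i)e^{−ημ_i}/((x−λ_i)A'(λ_i)))`, written with the polynomial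
`A(x)/(x−λ_i)`, so `C` is a polynomial in `x`. -/
def Cfun (n : ℕ) (α γ η : ℝ) (d : Polynomial ℝ) (x : ℝ)
    (z : (Fin n → ℝ) × (Fin n → ℝ)) : ℝ :=
  (γ / α) * Afun n α x z
    - ∑ i, d.eval (z.1 i) * Real.exp (-(η * z.2 i)) * lagr n α z i x / Ader n α z i

/-- Partial derivative of `F` with respect to `λ_i`. -/
def pdLam {n : ℕ} (F : (Fin n → ℝ) × (Fin n → ℝ) → ℝ) (i : Fin n)
    (z : (Fin n → ℝ) × (Fin n → ℝ)) : ℝ :=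
  fderiv ℝ F z (Pi.single i 1, 0)

/-- Partial derivative of `F` with respect to `μ_i`. -/
def pdMu {n : ℕ} (F : (Fin n → ℝ) × (Fin n → ℝ) → ℝ) (i : Fin n)
    (z : (Fin n → ℝ) × (Fin n → ℝ)) : ℝ :=
  fderiv ℝ F z (0, Pi.single i 1)

/-- The canonical bracket `{F,G}_0 := Σ_i (∂F/∂μ_i ∂G/∂λ_i − ∂F/∂λ_i ∂G/∂μ_i)`. -/
def bracket0 {n : ℕ} (F G : (Fin n → ℝ) × (Fin n → ℝ) → ℝ)
    (z : (Fin n → ℝ) × (Fin n → ℝ)) : ℝ :=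
  ∑ i, (pdMu F i z * pdLam G i z - pdLam F i z * pdMu G i z)

/-- The second bracket `{F,G}_1 := Σ_i λ_i (∂F/∂μ_i ∂G/∂λ_i − ∂F/∂λ_i ∂G/∂μ_i)`. -/
def bracket1 {n : ℕ} (F G : (Fin n → ℝ) × (Fin n → ℝ) → ℝ)
    (z : (Fin n → ℝ) × (Fin n → ℝ)) : ℝ :=
  ∑ i, z.1 i * (pdMu F i z * pdLam G i z - pdLam F i z * pdMu G i z)

theorem Afun_eq_mul_lagr {n : ℕ} (α x : ℝ) (z : (Fin n → ℝ) × (Fin n → ℝ)) (i : Fin n) :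
    Afun n α x z = (x - z.1 i) * lagr n α z i x := by
  rw [Afun, lagr, ← Finset.mul_prod_erase Finset.univ _ (Finset.mem_univ i)]
  ring

theorem Ader_eq_lagr {n : ℕ} (α : ℝ) (z : (Fin n → ℝ) × (Fin n → ℝ)) (i : Fin n) :
    Ader n α z i = lagr n α z i (z.1 i) := by
  have hd : DifferentiableAt ℝ (fun x => lagr n α z i x) (z.1 i) := by
    unfold lagr; fun_prop
  have h := ((hasDerivAt_id (z.1 i)).sub_const (z.1 i)).mul hd.hasDerivAt
  simp only [Ader, Afun_eq_mul_lagr α _ z i]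
  refine h.deriv.trans ?_
  simp

theorem Ader_ne_zero {n : ℕ} {α : ℝ} (hα : α ≠ 0) {z : (Fin n → ℝ) × (Fin n → ℝ)}
    (hz : z ∈ U n) (i : Fin n) : Ader n α z i ≠ 0 := by
  rw [Ader_eq_lagr, lagr]
  refine mul_ne_zero hα (Finset.prod_ne_zero_iff.2 fun j hj => sub_ne_zero.2 fun h => ?_)
  exact Finset.ne_of_mem_erase hj (hz h).symm

theorem differentiable_Afun (n : ℕ) (α x : ℝ) : Differentiable ℝ (Afun n α x) := by
  unfold Afun; fun_prop

theorem differentiable_lagr {n : ℕ} (α x : ℝ) (i : Fin n) :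
    Differentiable ℝ (fun w => lagr n α w i x) := by
  unfold lagr; fun_prop

theorem differentiable_Ader {n : ℕ} (α : ℝ) (i : Fin n) :
    Differentiable ℝ (fun w => Ader n α w i) := by
  simp only [Ader_eq_lagr, lagr]; fun_prop

theorem differentiableAt_Bfun {n : ℕ} {α : ℝ} (hα : α ≠ 0) (β η x : ℝ)
    {z : (Fin n → ℝ) × (Fin n → ℝ)} (hz : z ∈ U n) :
    DifferentiableAt ℝ (Bfun n α β η x) z := by
  unfold Bfun
  refine ((differentiable_Afun n α x z).const_mul _).add (.fun_sum fun i _ => ?_)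
  have hexp : DifferentiableAt ℝ
      (fun w : (Fin n → ℝ) × (Fin n → ℝ) => Real.exp (η * w.2 i)) z := by fun_prop
  simp only [div_eq_mul_inv]
  exact (hexp.fun_mul (differentiable_lagr α x i z)).fun_mul
    ((differentiable_Ader α i z).fun_inv (Ader_ne_zero hα hz i))

theorem pdMu_Afun {n : ℕ} (α x : ℝ) (i : Fin n) (z : (Fin n → ℝ) × (Fin n → ℝ)) :
    pdMu (Afun n α x) i z = 0 := by
  rw [pdMu, ← (differentiable_Afun n α x z).lineDeriv_eq_fderiv, lineDeriv]
  simp [Afun]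

theorem pdLam_Afun {n : ℕ} (α x : ℝ) (i : Fin n) (z : (Fin n → ℝ) × (Fin n → ℝ)) :
    pdLam (Afun n α x) i z = -lagr n α z i x := by
  rw [pdLam, ← (differentiable_Afun n α x z).lineDeriv_eq_fderiv, lineDeriv]
  have h : ∀ t : ℝ, Afun n α x (z + t • (Pi.single i 1, 0)) =
      (x - (z.1 i + t)) * lagr n α z i x := by
    intro t
    rw [Afun_eq_mul_lagr α x _ i]
    congr 1
    · simp
    · simp only [lagr]
      congr 1
      refine Finset.prod_congr rfl fun j hj => ?_
      simp [Finset.ne_of_mem_erase hj]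
  simp only [h]
  simp

theorem pdMu_Bfun {n : ℕ} {α : ℝ} (hα : α ≠ 0) (β η x : ℝ) (i : Fin n)
    {z : (Fin n → ℝ) × (Fin n → ℝ)} (hz : z ∈ U n) :
    pdMu (Bfun n α β η x) i z =
      η * (Real.exp (η * z.2 i) * lagr n α z i x / Ader n α z i) := by
  rw [pdMu, ← (differentiableAt_Bfun hα β η x hz).lineDeriv_eq_fderiv, lineDeriv]
  have h : ∀ t : ℝ, Bfun n α β η x (z + t • (0, Pi.single i 1)) =
      (β / α) * Afun n α x z +
        ∑ j, Real.exp (η * (z.2 j + t * Pi.single (M := fun _ => ℝ) i 1 j)) *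
          lagr n α z j x / Ader n α z j := by
    intro t
    simp [Bfun, Ader_eq_lagr, lagr, Afun]
  simp only [h]
  have hsum := HasDerivAt.fun_sum (u := Finset.univ) fun j (_ : j ∈ Finset.univ) =>
    (((((hasDerivAt_id (0 : ℝ)).mul_const (Pi.single (M := fun _ => ℝ) i 1 j)).const_add
      (z.2 j)).const_mul η).exp.mul_const (lagr n α z j x)).div_const (Ader n α z j)
  refine (hsum.const_add _).deriv.trans ?_
  rw [Finset.sum_eq_single i]
  · simp; ring
  · intro j _ hj
    simp [hj]
  · simp

/-!
STATEMENT 8: {B(x), A(y)}_1 = (η/(x−y))·(x·B(x)A(y) − y·B(y)A(x)) − (ηβ/α)·A(x)A(y) on U.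
-/
theorem second_bracket_BA (n : ℕ) (hn : 1 ≤ n) (α β η : ℝ) (hα : α ≠ 0)
    (x y : ℝ) (hxy : x ≠ y) (z : (Fin n → ℝ) × (Fin n → ℝ)) (hz : z ∈ U n) :
    bracket1 (fun w => Bfun n α β η x w) (fun w => Afun n α y w) z =
      η / (x - y) * (x * Bfun n α β η x z * Afun n α y z
          - y * Bfun n α β η y z * Afun n α x z)
        - (η * β / α) * (Afun n α x z * Afun n α y z) := by
  have hxy' : x - y ≠ 0 := sub_ne_zero.2 hxy
  have hterm : ∀ i : Fin n,
      z.1 i * (pdMu (Bfun n α β η x) i z * pdLam (Afun n α y) i z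
        - pdLam (Bfun n α β η x) i z * pdMu (Afun n α y) i z) =
      η / (x - y) *
        (x * (Real.exp (η * z.2 i) * lagr n α z i x / Ader n α z i) * Afun n α y z
          - y * (Real.exp (η * z.2 i) * lagr n α z i y / Ader n α z i) * Afun n α x z) := by
    intro i
    have hA := Ader_ne_zero hα hz i
    rw [pdMu_Bfun hα β η x i hz, pdLam_Afun, pdMu_Afun, Afun_eq_mul_lagr α x z i,
      Afun_eq_mul_lagr α y z i]
    field_simp
    ring
  change ∑ i, z.1 i * (pdMu (Bfun n α β η x) i z * pdLam (Afun n α y) i z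
    - pdLam (Bfun n α β η x) i z * pdMu (Afun n α y) i z) = _
  rw [Finset.sum_congr rfl fun i _ => hterm i, ← Finset.mul_sum, Finset.sum_sub_distrib,
    ← Finset.sum_mul, ← Finset.sum_mul, ← Finset.mul_sum, ← Finset.mul_sum, Bfun, Bfun]
  field_simp
  ring

end
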